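/- In the bigraded setup below, assume in addition that d_1 ≥ 2, that d_1 ≤ d_j for all j, and that f_1 = z_1^{d_1} + z_2^{d_1} + ⋯ + z_{N+k+1}^{d_1}. Then dim_ℂ R_{1,−1} = dim_ℂ R′_{1,−1} − (N+k+1). -/

import Mathlib

open MvPolynomial

noncomputable section

/-- The polynomial ring `S = ℂ[z_1,…,z_{N+k+1}, w_1,…,w_k]`. -/
abbrev SRing (N k : ℕ) : Type := MvPolynomial (Fin (N + k + 1) ⊕ Fin k) ℂ

/-- The bigrading on `S`: `deg z_s = (0,1)` and `deg w_j = (1, -d_j)`. -/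
def wt (N k : ℕ) (d : Fin k → ℕ) : Fin (N + k + 1) ⊕ Fin k → ℤ × ℤ :=
  Sum.elim (fun _ => ((0 : ℤ), (1 : ℤ))) (fun j => ((1 : ℤ), -(d j : ℤ)))

/-- `F = w_1 f_1 + ⋯ + w_k f_k ∈ S`. -/
def bigF (N k : ℕ) (f : Fin k → MvPolynomial (Fin (N + k + 1)) ℂ) : SRing N k :=
  ∑ j : Fin k, X (Sum.inr j) * rename Sum.inl (f j)

/-- The ideal `J(F)` generated by all the partial derivatives of `F`. -/
def Jfull (N k : ℕ) (f : Fin k → MvPolynomial (Fin (N + k + 1)) ℂ) : Ideal (SRing N k) :=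
  Ideal.span (Set.range fun v : Fin (N + k + 1) ⊕ Fin k => pderiv v (bigF N k f))

/-- The ideal `J'(F)` generated by `∂F/∂w_1, …, ∂F/∂w_k` alone. -/
def Jprime (N k : ℕ) (f : Fin k → MvPolynomial (Fin (N + k + 1)) ℂ) : Ideal (SRing N k) :=
  Ideal.span (Set.range fun j : Fin k => pderiv (Sum.inr j) (bigF N k f))

lemma Jprime_le_Jfull (N k : ℕ) (f : Fin k → MvPolynomial (Fin (N + k + 1)) ℂ) :
    Jprime N k f ≤ Jfull N k f :=
  Ideal.span_mono (by rintro x ⟨j, rfl⟩; exact ⟨Sum.inr j, rfl⟩)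

/-- The bidegree-`(p,q)` component of `S`. -/
def Scomp (N k : ℕ) (d : Fin k → ℕ) (p q : ℤ) : Submodule ℂ (SRing N k) :=
  weightedHomogeneousSubmodule ℂ (wt N k d) (p, q)

/-- The bidegree-`(p,q)` component of `R = S/J(F)`. -/
def Rcomp (N k : ℕ) (d : Fin k → ℕ) (f : Fin k → MvPolynomial (Fin (N + k + 1)) ℂ)
    (p q : ℤ) : Submodule ℂ (SRing N k ⧸ Jfull N k f) :=
  Submodule.map (Ideal.Quotient.mkₐ ℂ (Jfull N k f)).toLinearMap (Scomp N k d p q)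

/-- The bidegree-`(p,q)` component of `R' = S/J'(F)`. -/
def R'comp (N k : ℕ) (d : Fin k → ℕ) (f : Fin k → MvPolynomial (Fin (N + k + 1)) ℂ)
    (p q : ℤ) : Submodule ℂ (SRing N k ⧸ Jprime N k f) :=
  Submodule.map (Ideal.Quotient.mkₐ ℂ (Jprime N k f)).toLinearMap (Scomp N k d p q)

open LinearMap in
lemma LinearMap.finrank_map_add_finrank_inf_ker {K E Q : Type*} [Field K] [AddCommGroup E]
    [Module K E] [AddCommGroup Q] [Module K Q] (q : E →ₗ[K] Q) (V : Submodule K E)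
    [FiniteDimensional K V] :
    Module.finrank K (V.map q) + Module.finrank K (V ⊓ ker q : Submodule K E)
      = Module.finrank K V := by
  rw [← (q.domRestrict V).finrank_range_add_finrank_ker, LinearMap.range_domRestrict,
    ← Submodule.map_comap_subtype, Submodule.finrank_map_subtype_eq]
  rfl

open LinearMap in
lemma finrank_map_add_card_of_inf_ker_le {K E Q Q' ι : Type*} [Field K] [AddCommGroup E]
    [Module K E] [AddCommGroup Q] [Module K Q] [AddCommGroup Q'] [Module K Q'] [Fintype ι]
    (q : E →ₗ[K] Q) (q' : E →ₗ[K] Q') (hker : ker q' ≤ ker q) (V : Submodule K E)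
    [FiniteDimensional K V] (v : ι → E) (hvV : ∀ i, v i ∈ V) (hvq : ∀ i, q (v i) = 0)
    (hv : LinearIndependent K (q' ∘ v))
    (hle : V ⊓ ker q ≤ ker q' ⊔ Submodule.span K (Set.range v)) :
    Module.finrank K (V.map q) + Fintype.card ι = Module.finrank K (V.map q') := by
  have hspanV : Submodule.span K (Set.range v) ≤ V :=
    Submodule.span_le.2 (Set.range_subset_iff.2 hvV)
  have hspanq : Submodule.span K (Set.range v) ≤ ker q :=
    Submodule.span_le.2 (Set.range_subset_iff.2 hvq)
  have hsup : V ⊓ ker q = V ⊓ ker q' ⊔ Submodule.span K (Set.range v) := by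
    refine le_antisymm ?_ (sup_le (inf_le_inf_left V hker) (le_inf hspanV hspanq))
    rw [sup_comm, inf_comm V (ker q'), ← sup_inf_assoc_of_le _ hspanV]
    exact le_inf (hle.trans_eq (sup_comm _ _)) inf_le_left
  have hdisj : V ⊓ ker q' ⊓ Submodule.span K (Set.range v) = ⊥ := by
    refine (Submodule.eq_bot_iff _).2 ?_
    rintro x ⟨⟨-, hx⟩, hxs⟩
    obtain ⟨c, rfl⟩ := (Submodule.mem_span_range_iff_exists_fun K).1 hxs
    have hc := Fintype.linearIndependent_iff.1 hv c (by simpa using hx)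
    simp [hc]
  have hfin : FiniteDimensional K (V ⊓ ker q' : Submodule K E) :=
    Submodule.finiteDimensional_inf_left _ _
  have hfinspan := FiniteDimensional.span_of_finite K (Set.finite_range v)
  have hspan := finrank_span_eq_card (hv.of_comp q')
  have h := Submodule.finrank_sup_add_finrank_inf_eq (V ⊓ ker q') (Submodule.span K (Set.range v))
  rw [← hsup, hdisj, finrank_bot, hspan] at h
  have h₁ := q.finrank_map_add_finrank_inf_ker V
  have h₂ := q'.finrank_map_add_finrank_inf_ker V
  omega

namespace MvPolynomial

lemma weightedHomogeneousComponent_mul_of_right_mem {σ R M : Type*} [CommSemiring R]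
    [AddCancelCommMonoid M] {w : σ → M} (m : M) {n : M} (φ : MvPolynomial σ R)
    {ψ : MvPolynomial σ R} (hψ : ψ.IsWeightedHomogeneous w n) :
    weightedHomogeneousComponent w (m + n) (φ * ψ)
      = weightedHomogeneousComponent w m φ * ψ := by
  classical
  let := weightedGradedAlgebra R w
  have h := DirectSum.coe_decompose_mul_add_of_right_mem (weightedHomogeneousSubmodule R w)
    (i := m) (a := φ) ((mem_weightedHomogeneousSubmodule R w n ψ).2 hψ)
  rwa [← weightedDecomposition.decompose'_apply, ← weightedDecomposition.decompose'_apply]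

lemma IsHomogeneous.coeff_mul_eq_zero {σ R : Type*} [CommSemiring R] {n : ℕ}
    {p : MvPolynomial σ R} (hp : p.IsHomogeneous n) (a : MvPolynomial σ R) {m : σ →₀ ℕ}
    (hm : m.degree < n) : coeff m (a * p) = 0 := by
  classical
  rw [coeff_mul]
  refine Finset.sum_eq_zero fun x hx => ?_
  rw [hp.coeff_eq_zero, mul_zero]
  rw [← Finset.HasAntidiagonal.mem_antidiagonal.1 hx, map_add] at hm
  omega

end MvPolynomial

section Bigrading

variable {N k : ℕ} {d : Fin k → ℕ} {f : Fin k → MvPolynomial (Fin (N + k + 1)) ℂ}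

lemma weight_wt (m : Fin (N + k + 1) ⊕ Fin k →₀ ℕ) :
    Finsupp.weight (wt N k d) m
      = (∑ j, (m (Sum.inr j) : ℤ), ∑ s, (m (Sum.inl s) : ℤ) - ∑ j, (m (Sum.inr j) : ℤ) * d j) := by
  rw [Finsupp.weight_apply, Finsupp.sum_fintype _ _ (by simp), Fintype.sum_sum_type]
  ext <;> simp [wt, Prod.fst_sum, Prod.snd_sum, sub_eq_add_neg]

lemma finite_weight_wt_one_eq (q : ℤ) :
    {m : Fin (N + k + 1) ⊕ Fin k →₀ ℕ | Finsupp.weight (wt N k d) m = (1, q)}.Finite := by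
  refine (Set.finite_Iic (Finsupp.equivFunOnFinite.symm
    fun _ : Fin (N + k + 1) ⊕ Fin k => 1 + q.natAbs + ∑ j, d j)).subset fun m hm => ?_
  rw [Set.mem_ofPred_eq, weight_wt, Prod.mk.injEq] at hm
  obtain ⟨h₁, h₂⟩ := hm
  have hw : ∀ j, (m (Sum.inr j) : ℤ) ≤ 1 := fun j =>
    (Finset.single_le_sum (f := fun j => (m (Sum.inr j) : ℤ)) (fun _ _ => by positivity)
      (Finset.mem_univ j)).trans_eq h₁
  have hd : ∑ j, (m (Sum.inr j) : ℤ) * d j ≤ ∑ j, (d j : ℤ) :=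
    Finset.sum_le_sum fun j _ => by nlinarith [hw j]
  have hd0 : (0 : ℤ) ≤ ∑ j, (d j : ℤ) := by positivity
  rw [Set.mem_Iic, Finsupp.le_def]
  rintro (s | j) <;> rw [Finsupp.equivFunOnFinite_symm_apply_apply] <;> zify
  · have := Finset.single_le_sum (f := fun s => (m (Sum.inl s) : ℤ)) (fun _ _ => by positivity)
      (Finset.mem_univ s)
    have := le_abs_self q
    linarith
  · have := hw j
    have := abs_nonneg q
    linarith

instance finiteDimensional_Scomp_one (q : ℤ) : FiniteDimensional ℂ (Scomp N k d 1 q) := by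
  rw [Scomp, weightedHomogeneousSubmodule_eq_finsupp_supported]
  have := (finite_weight_wt_one_eq (N := N) (d := d) q).to_subtype
  exact Module.Finite.of_basis (basisRestrictSupport ℂ _)

lemma eq_zero_of_weight_wt_eq_zero {m : Fin (N + k + 1) ⊕ Fin k →₀ ℕ}
    (hm : Finsupp.weight (wt N k d) m = 0) : m = 0 := by
  rw [weight_wt, Prod.mk_eq_zero] at hm
  obtain ⟨h₁, h₂⟩ := hm
  have hw : ∀ j, m (Sum.inr j) = 0 := by
    simpa [Finset.sum_eq_zero_iff_of_nonneg] using h₁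
  have hz : ∀ s, m (Sum.inl s) = 0 := by
    simpa [Finset.sum_eq_zero_iff_of_nonneg, hw] using h₂
  ext (s | j) <;> simp [hw, hz]

lemma eq_C_of_isWeightedHomogeneous_wt_zero {p : SRing N k}
    (hp : p.IsWeightedHomogeneous (wt N k d) 0) : p = C (coeff 0 p) := by
  ext m
  rw [coeff_C]
  split_ifs with h
  · rw [h]
  · exact hp.coeff_eq_zero m fun hm => h (eq_zero_of_weight_wt_eq_zero hm).symm

lemma isWeightedHomogeneous_rename_inl {p : MvPolynomial (Fin (N + k + 1)) ℂ} {n : ℕ}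
    (hp : p.IsHomogeneous n) :
    (rename Sum.inl p : SRing N k).IsWeightedHomogeneous (wt N k d) (0, n) := by
  intro m hm
  obtain ⟨u, rfl, hu⟩ := coeff_rename_ne_zero _ _ _ hm
  have hdeg : u.degree = n := by
    by_contra h
    exact hu (hp.coeff_eq_zero h)
  have hl : ∀ s, u.mapDomain (Sum.inl : _ → Fin (N + k + 1) ⊕ Fin k) (Sum.inl s) = u s :=
    fun s => Finsupp.mapDomain_apply Sum.inl_injective u s
  have hr : ∀ j, u.mapDomain (Sum.inl : _ → Fin (N + k + 1) ⊕ Fin k) (Sum.inr j) = 0 :=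
    fun j => Finsupp.mapDomain_of_notMem_range u _ (by simp)
  rw [weight_wt, ← hdeg, Finsupp.degree_eq_sum]
  simp [hl, hr]

lemma pderiv_inr_bigF (j : Fin k) :
    pderiv (Sum.inr j) (bigF N k f) = rename Sum.inl (f j) := by
  classical
  have h : ∀ i, pderiv (Sum.inr j) (rename Sum.inl (f i) : SRing N k) = 0 := fun i =>
    pderiv_eq_zero_of_notMem_vars fun hj => by
      obtain ⟨_, _, hs⟩ := mem_vars_rename _ _ hj
      exact Sum.inl_ne_inr hs
  simp [bigF, h, pderiv_X, Pi.single_apply, Sum.inr_injective.eq_iff]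

lemma pderiv_inl_bigF (s : Fin (N + k + 1)) :
    pderiv (Sum.inl s) (bigF N k f)
      = ∑ j, X (Sum.inr j) * rename Sum.inl (pderiv s (f j)) := by
  classical
  simp [bigF, pderiv_rename Sum.inl_injective, pderiv_X]

lemma isWeightedHomogeneous_bigF (hfhom : ∀ j, (f j).IsHomogeneous (d j)) :
    (bigF N k f).IsWeightedHomogeneous (wt N k d) (1, 0) := by
  refine (weightedHomogeneousSubmodule ℂ (wt N k d) (1, 0)).sum_mem fun j _ => ?_
  have h := (isWeightedHomogeneous_X ℂ (wt N k d) (Sum.inr j)).mul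
    (isWeightedHomogeneous_rename_inl (d := d) (hfhom j))
  simpa [wt] using h

lemma isWeightedHomogeneous_pderiv_inl_bigF (hfhom : ∀ j, (f j).IsHomogeneous (d j))
    (s : Fin (N + k + 1)) :
    (pderiv (Sum.inl s) (bigF N k f)).IsWeightedHomogeneous (wt N k d) (1, -1) :=
  (isWeightedHomogeneous_bigF hfhom).pderiv (by simp [wt])

lemma Scomp_inf_Jfull_le (hfhom : ∀ j, (f j).IsHomogeneous (d j)) :
    Scomp N k d 1 (-1) ⊓ (Jfull N k f).restrictScalars ℂ
      ≤ (Jprime N k f).restrictScalars ℂ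
        ⊔ Submodule.span ℂ (Set.range fun s => pderiv (Sum.inl s) (bigF N k f)) := by
  rintro x ⟨hx, hxJ⟩
  obtain ⟨c, rfl⟩ := Ideal.mem_span_range_iff_exists_fun.1 hxJ
  rw [← IsWeightedHomogeneous.weightedHomogeneousComponent_same hx, map_sum]
  refine Submodule.sum_mem _ fun v _ => ?_
  rcases v with s | j
  · refine Submodule.mem_sup_right ?_
    have h := weightedHomogeneousComponent_mul_of_right_mem 0 (c (Sum.inl s))
      (isWeightedHomogeneous_pderiv_inl_bigF hfhom s)
    rw [zero_add] at h
    rw [h, eq_C_of_isWeightedHomogeneous_wt_zero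
      (weightedHomogeneousComponent_isWeightedHomogeneous 0 (c (Sum.inl s))), ← smul_eq_C_mul]
    exact Submodule.smul_mem _ _ (Submodule.subset_span ⟨s, rfl⟩)
  · refine Submodule.mem_sup_left ?_
    have h := weightedHomogeneousComponent_mul_of_right_mem (1, -1 - (d j : ℤ)) (c (Sum.inr j))
      (isWeightedHomogeneous_rename_inl (d := d) (hfhom j))
    rw [Prod.mk_add_mk, add_zero, sub_add_cancel, ← pderiv_inr_bigF] at h
    rw [h]
    exact Ideal.mul_mem_left _ _ (Ideal.subset_span ⟨j, rfl⟩)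

/-- Setting `w_i = 1` and the other `w_j` to `0` sends `J'(F)` into the ideal `(f_1, …, f_k)` and
`∂F/∂z_s` to `∂f_i/∂z_s`. -/
def evalW (N : ℕ) {k : ℕ} (i : Fin k) : SRing N k →ₐ[ℂ] MvPolynomial (Fin (N + k + 1)) ℂ :=
  aeval (Sum.elim X (Pi.single i 1))

lemma evalW_rename_inl (i : Fin k) (p : MvPolynomial (Fin (N + k + 1)) ℂ) :
    evalW N i (rename Sum.inl p) = p := by
  rw [evalW, aeval_rename, Sum.elim_comp_inl, aeval_X_left_apply]

lemma evalW_pderiv_inl_bigF (i : Fin k) (s : Fin (N + k + 1)) :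
    evalW N i (pderiv (Sum.inl s) (bigF N k f)) = pderiv s (f i) := by
  simp only [pderiv_inl_bigF, map_sum, map_mul, evalW_rename_inl]
  simp [evalW, Pi.single_apply]

lemma coeff_evalW_eq_zero_of_mem_Jprime (hfhom : ∀ j, (f j).IsHomogeneous (d j)) (i : Fin k)
    {x : SRing N k} (hx : x ∈ Jprime N k f) {m : Fin (N + k + 1) →₀ ℕ}
    (hm : ∀ j, m.degree < d j) : coeff m (evalW N i x) = 0 := by
  obtain ⟨c, rfl⟩ := Ideal.mem_span_range_iff_exists_fun.1 hx
  simp only [pderiv_inr_bigF, map_sum, map_mul, evalW_rename_inl, coeff_sum]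
  exact Finset.sum_eq_zero fun j _ => (hfhom j).coeff_mul_eq_zero _ (hm j)

lemma linearIndependent_mk_pderiv_bigF (hfhom : ∀ j, (f j).IsHomogeneous (d j)) (i : Fin k)
    (hdi : 2 ≤ d i) (hmin : ∀ j, d i ≤ d j) (hfi : f i = ∑ s, X s ^ d i) :
    LinearIndependent ℂ ((Ideal.Quotient.mkₐ ℂ (Jprime N k f)).toLinearMap ∘
      fun s => pderiv (Sum.inl s) (bigF N k f)) := by
  classical
  have hpd : ∀ s, pderiv s (f i) = monomial (Finsupp.single s (d i - 1)) (d i : ℂ) := by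
    intro s
    rw [hfi, map_sum, Finset.sum_eq_single s]
    · rw [X_pow_eq_monomial, pderiv_monomial]
      simp [Finsupp.single_tsub]
    · intro t _ hts
      simp [pderiv_X_of_ne hts]
    · simp
  refine Fintype.linearIndependent_iff.2 fun c hc s => ?_
  have hmem : ∑ t, c t • pderiv (Sum.inl t) (bigF N k f) ∈ Jprime N k f := by
    rw [← Ideal.Quotient.eq_zero_iff_mem, ← Ideal.Quotient.mkₐ_eq_mk ℂ]
    simpa using hc
  have h := coeff_evalW_eq_zero_of_mem_Jprime hfhom i hmem
    (m := Finsupp.single s (d i - 1)) fun j => by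
      have := hmin j
      rw [Finsupp.degree_single]
      omega
  have hinj : ∀ t, Finsupp.single t (d i - 1) = Finsupp.single s (d i - 1) ↔ t = s := fun t =>
    Finsupp.single_left_inj (by omega)
  simp only [map_sum, map_smul, evalW_pderiv_inl_bigF, hpd, coeff_sum, coeff_smul, coeff_monomial,
    hinj, smul_eq_mul, mul_ite, mul_zero, Finset.sum_ite_eq', Finset.mem_univ, if_true] at h
  exact (mul_eq_zero.1 h).resolve_right (Nat.cast_ne_zero.2 (by omega))

end Bigrading

/-- **Lemma 3.4, second part.** If `d_1 ≥ 2` is minimal among the degrees and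
`f_1 = z_1^{d_1} + ⋯ + z_{N+k+1}^{d_1}`, then
`dim_ℂ R_{1,-1} = dim_ℂ R'_{1,-1} - (N+k+1)`. -/
theorem finrank_Rcomp_one_neg_one (N k : ℕ) (hN : 1 ≤ N) (hk : 1 ≤ k)
    (d : Fin k → ℕ) (hd : ∀ j, 1 ≤ d j)
    (f : Fin k → MvPolynomial (Fin (N + k + 1)) ℂ)
    (hfhom : ∀ j, (f j).IsHomogeneous (d j))
    (hd1 : 2 ≤ d ⟨0, hk⟩) (hmin : ∀ j, d ⟨0, hk⟩ ≤ d j)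
    (hf1 : f ⟨0, hk⟩ = ∑ s : Fin (N + k + 1), (X s : MvPolynomial (Fin (N + k + 1)) ℂ) ^ d ⟨0, hk⟩) :
    (Module.finrank ℂ (Rcomp N k d f 1 (-1)) : ℤ)
      = (Module.finrank ℂ (R'comp N k d f 1 (-1)) : ℤ) - (N + k + 1) := by
  have hker : ∀ I : Ideal (SRing N k),
      LinearMap.ker (Ideal.Quotient.mkₐ ℂ I).toLinearMap = I.restrictScalars ℂ := fun I => by
    ext x
    exact Ideal.Quotient.eq_zero_iff_mem
  have h := finrank_map_add_card_of_inf_ker_le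
    (Ideal.Quotient.mkₐ ℂ (Jfull N k f)).toLinearMap
    (Ideal.Quotient.mkₐ ℂ (Jprime N k f)).toLinearMap
    (by rw [hker, hker]; exact Jprime_le_Jfull N k f) (Scomp N k d 1 (-1))
    (fun s => pderiv (Sum.inl s) (bigF N k f))
    (isWeightedHomogeneous_pderiv_inl_bigF hfhom)
    (fun s => Ideal.Quotient.eq_zero_iff_mem.2 (Ideal.subset_span ⟨Sum.inl s, rfl⟩))
    (linearIndependent_mk_pderiv_bigF hfhom _ hd1 hmin hf1)
    (by rw [hker, hker]; exact Scomp_inf_Jfull_le hfhom)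
  rw [Fintype.card_fin] at h
  rw [Rcomp, R'comp, ← h]
  push_cast
  ring
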